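/- arXiv:1512.00274 — 7 statements merged into one kernel-verified Lean document; each statement's English description precedes it below -/
import Mathlib

section
/- Let n ≥ 1 and let F : (Fin n → Bool) → (Fin n → Bool) be a Boolean mapping with coordinate functions f_i(x) = F(x) i. Suppose there exist a permutation σ of Fin n, pairwise distinct indices j_0, …, j_{n-1} in Fin n, and Boolean functions g_0, …, g_{n-1} : (Fin n → Bool) → Bool such that for every k ∈ {0, …, n-1}: (i) f_{σ(k)}(x) = x_{j_k} XOR g_k(x) for all x, where g_k does not depend on variable j_k (so j_k is a free variable of f_{σ(k)}); and (ii) g_0 depends on no variables (it is a constant function), and for k ≥ 1 the dependence set dep(g_k) is contained in the union dep(f_{σ(0)}) ∪ dep(f_{σ(1)}) ∪ … ∪ dep(f_{σ(k-1)}). Then F is a bijection of (Fin n → Bool) onto itself. -/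
/-- `h` does not depend on variable `i`. -/
def DoesNotDependOn {n : ℕ} (h : (Fin n → Bool) → Bool) (i : Fin n) : Prop :=
  ∀ (x : Fin n → Bool) (b : Bool), h x = h (Function.update x i b)

/-- The dependence set of `h`: the set of variables on which `h` depends. -/
def dep {n : ℕ} (h : (Fin n → Bool) → Bool) : Set (Fin n) :=
  {i | ¬ DoesNotDependOn h i}

/-- A Boolean function takes equal values at points agreeing on its dependence set. -/
theorem eq_of_eqOn_dep {n : ℕ} {h : (Fin n → Bool) → Bool} {x y : Fin n → Bool}
    (hxy : Set.EqOn x y (dep h)) : h x = h y := by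
  have key : ∀ s : Finset (Fin n), h x = h (s.piecewise y x) := by
    intro s
    induction s using Finset.induction_on with
    | empty => simp
    | insert i s his ih =>
      rw [ih, Finset.piecewise_insert]
      by_cases hi : DoesNotDependOn h i
      · exact hi _ _
      · have hx : y i = s.piecewise y x i := by
          rw [Finset.piecewise_eq_of_notMem s y x his]
          exact (hxy hi).symm
        rw [hx, Function.update_eq_self]
  simpa using key Finset.univ

/-- A function of the form `x i xor g x` depends at most on `i` and the variables of `g`. -/
theorem dep_subset_insert_of_eq_xor {n : ℕ} {h g : (Fin n → Bool) → Bool} {i : Fin n}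
    (hg : ∀ x, h x = xor (x i) (g x)) : dep h ⊆ insert i (dep g) := by
  intro l hl
  by_contra hcon
  rw [Set.mem_insert_iff, not_or] at hcon
  refine hl fun x b => ?_
  have hgl : DoesNotDependOn g l := not_not.mp hcon.2
  rw [hg, hg, ← hgl x b, Function.update_of_ne (Ne.symm hcon.1)]

theorem sufficient_condition_invertible
    (n : ℕ) (hn : 1 ≤ n)
    (F : (Fin n → Bool) → (Fin n → Bool))
    (σ : Equiv.Perm (Fin n))
    (j : Fin n → Fin n) (hj : Function.Injective j)
    (g : Fin n → (Fin n → Bool) → Bool)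
    (hform : ∀ (k : Fin n) (x : Fin n → Bool), F x (σ k) = xor (x (j k)) (g k x))
    (hfree : ∀ k : Fin n, DoesNotDependOn (g k) (j k))
    (htri : ∀ k : Fin n,
      dep (g k) ⊆ ⋃ (m : Fin n) (_ : m < k), dep (fun x => F x (σ m))) :
    Function.Bijective F := by
  have hdep : ∀ k : Fin n, dep (fun x => F x (σ k)) ⊆ j '' Set.Iic k := by
    intro k
    induction k using WellFoundedLT.induction with
    | ind k ih =>
      refine (dep_subset_insert_of_eq_xor (hform k)).trans (Set.insert_subset ?_ ?_)
      · exact Set.mem_image_of_mem j Set.self_mem_Iic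
      · refine (htri k).trans (Set.iUnion₂_subset fun m hm => (ih m hm).trans ?_)
        exact Set.image_mono (Set.Iic_subset_Iic.mpr hm.le)
  refine Finite.injective_iff_bijective.mp fun x y hxy => ?_
  have hagree : ∀ k : Fin n, x (j k) = y (j k) := by
    intro k
    induction k using WellFoundedLT.induction with
    | ind k ih =>
      have hg : g k x = g k y := by
        refine eq_of_eqOn_dep fun i hi => ?_
        obtain ⟨m, hm, him⟩ := Set.mem_iUnion₂.mp (htri k hi)
        obtain ⟨l, hl, rfl⟩ := hdep m him
        exact ih l (lt_of_le_of_lt hl hm)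
      have hF := congrFun hxy (σ k)
      rw [hform, hform, hg] at hF
      exact Bool.xor_left_inj.mp hF
  funext i
  obtain ⟨k, rfl⟩ := Finite.surjective_of_injective hj i
  exact hagree k
end

section
/- Let n ≥ 2. For every choice of a constant c : Bool and Boolean functions g_1, …, g_{n-1} where each g_k : (Fin n → Bool) → Bool depends only on the variables x_1, …, x_k, the mapping F : (Fin n → Bool) → (Fin n → Bool) defined by F(x) k = x_{k+1} XOR g_k(x) for 0 ≤ k ≤ n-2 (with g_0 the constant function c) and F(x) (n-1) = x_0 XOR g_{n-1}(x) is a bijection of (Fin n → Bool) onto itself. -/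
/-- A function takes equal values at two points that differ only in variables
it does not depend on. -/
theorem eq_of_not_dependsOn_of_ne {n : ℕ} {h : (Fin n → Bool) → Bool} {x y : Fin n → Bool}
    (hxy : ∀ i, x i ≠ y i → DoesNotDependOn h i) : h x = h y := by
  have key : ∀ s : Finset (Fin n), h x = h (s.piecewise y x) := by
    intro s
    induction s using Finset.induction_on with
    | empty => simp
    | insert j s hj ih =>
      rw [Finset.piecewise_insert, ih]
      by_cases hne : x j = y j
      · rw [← hne, ← Finset.piecewise_eq_of_notMem s y x hj, Function.update_eq_self]
      · exact hxy j hne _ _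
  simpa using key Finset.univ

theorem cyclic_instance_invertible
    (n : ℕ) (hn : 2 ≤ n) (c : Bool)
    (g : Fin n → (Fin n → Bool) → Bool)
    (hg0 : ∀ x, g ⟨0, by omega⟩ x = c)
    (hgdep : ∀ (k i : Fin n), ((i : ℕ) = 0 ∨ (k : ℕ) < (i : ℕ)) →
      DoesNotDependOn (g k) i)
    (F : (Fin n → Bool) → (Fin n → Bool))
    (hF : ∀ (x : Fin n → Bool) (k : Fin n),
      F x k = xor (x ⟨((k : ℕ) + 1) % n, Nat.mod_lt _ (by omega)⟩) (g k x)) :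
    Function.Bijective F := by
  refine Finite.injective_iff_bijective.mp fun x y hxy => ?_
  have step : ∀ k : Fin n, (∀ i : Fin n, 1 ≤ (i : ℕ) → (i : ℕ) ≤ k → x i = y i) →
      x ⟨((k : ℕ) + 1) % n, Nat.mod_lt _ (by omega)⟩ =
        y ⟨((k : ℕ) + 1) % n, Nat.mod_lt _ (by omega)⟩ := by
    intro k hk
    have hg : g k x = g k y := eq_of_not_dependsOn_of_ne fun i hi =>
      hgdep k i (by
        by_contra hcon
        exact hi (hk i (by omega) (by omega)))
    have h := congrFun hxy k
    rw [hF, hF, hg] at h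
    exact Bool.xor_left_inj.mp h
  have pos : ∀ m : ℕ, ∀ hm : m < n, 1 ≤ m → x ⟨m, hm⟩ = y ⟨m, hm⟩ := by
    intro m
    induction m using Nat.strong_induction_on with
    | _ m ih =>
      intro hm h1
      have h := step ⟨m - 1, by omega⟩ fun i hi hik => ih i (by grind) i.isLt hi
      simpa only [Nat.sub_add_cancel h1, Nat.mod_eq_of_lt hm] using h
  funext i
  by_cases hi : 1 ≤ (i : ℕ)
  · exact pos i i.isLt hi
  · have h := step ⟨n - 1, by omega⟩ fun j hj _ => pos j j.isLt hj
    have hi0 : i = ⟨0, by omega⟩ := Fin.ext (by simp only; omega)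
    have hn1 : n - 1 + 1 = n := by omega
    simpa only [hn1, Nat.mod_self, hi0] using h
end

section
/- Let n ≥ 1. For every family of functions g_k : (Fin k → Bool) → Bool (one for each k ∈ {0, …, n-1}, where g_0 is a constant), the mapping F : (Fin n → Bool) → (Fin n → Bool) defined by F(x) k = x_k XOR g_k(x restricted to the coordinates 0, …, k-1) is a bijection of (Fin n → Bool) onto itself. -/
theorem tfunction_triangular_invertible
    (n : ℕ) (hn : 1 ≤ n)
    (g : (k : Fin n) → (Fin (k : ℕ) → Bool) → Bool)
    (F : (Fin n → Bool) → (Fin n → Bool))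
    (hF : ∀ (x : Fin n → Bool) (k : Fin n),
      F x k = xor (x k) (g k (fun i => x ⟨(i : ℕ), i.isLt.trans k.isLt⟩))) :
    Function.Bijective F := by
  refine Finite.injective_iff_bijective.mp fun x y hxy => funext fun k => ?_
  induction k using WellFoundedLT.induction with
  | ind k ih =>
    have restrict_eq : (fun i : Fin (k : ℕ) => x ⟨(i : ℕ), i.isLt.trans k.isLt⟩) =
        fun i : Fin (k : ℕ) => y ⟨(i : ℕ), i.isLt.trans k.isLt⟩ :=
      funext fun i => ih ⟨i, i.isLt.trans k.isLt⟩ i.isLt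
    have hk := congrFun hxy k
    rw [hF, hF, restrict_eq] at hk
    exact Bool.xor_left_inj.mp hk
end

section
/- Let n ≥ 1 and let F : (Fin n → Bool) → (Fin n → Bool) be a T-function, i.e., for each i the coordinate function f_i(x) = F(x) i depends only on the variables x_0, …, x_i. Then F is a bijection of (Fin n → Bool) onto itself if and only if for every i ∈ {0, …, n-1} there exists a function g_i : (Fin n → Bool) → Bool that does not depend on variable i (and depends only on the variables x_0, …, x_{i-1}) such that f_i(x) = x_i XOR g_i(x) for all x. -/
theorem DoesNotDependOn.eq_piecewise {n : ℕ} {h : (Fin n → Bool) → Bool} (s : Finset (Fin n))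
    (hs : ∀ m ∈ s, DoesNotDependOn h m) (x y : Fin n → Bool) :
    h x = h (s.piecewise y x) := by
  induction s using Finset.induction_on with
  | empty => simp
  | insert a s _ ih =>
    rw [Finset.piecewise_insert, ← hs a (Finset.mem_insert_self a s),
      ← ih fun m hm => hs m (Finset.mem_insert_of_mem hm)]

/-- A function depending only on the variables in `{j | p j}` agrees on points agreeing there. -/
theorem DoesNotDependOn.eq_of_agree {n : ℕ} {h : (Fin n → Bool) → Bool} (p : Fin n → Prop)
    (hp : ∀ m, ¬ p m → DoesNotDependOn h m) {x y : Fin n → Bool}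
    (hxy : ∀ j, p j → x j = y j) : h x = h y := by
  classical
  rw [eq_piecewise (h := h) (Finset.univ.filter fun m => ¬ p m) (by simpa using hp) x y]
  congr 1
  ext j
  by_cases hj : p j <;> simp [Finset.piecewise, hj, hxy]

/-- A surjective T-function acts injectively on prefixes. -/
theorem agree_of_surjective_of_agree_image {n : ℕ} {F : (Fin n → Bool) → (Fin n → Bool)}
    (hT : ∀ (i m : Fin n), i < m → DoesNotDependOn (fun x => F x i) m)
    (hF : Function.Surjective F) (i : Fin n) {x y : Fin n → Bool}
    (hxy : ∀ j ≤ i, F x j = F y j) : ∀ j ≤ i, x j = y j := by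
  let extend : ({j : Fin n // j ≤ i} → Bool) → Fin n → Bool :=
    fun q j => if hj : j ≤ i then q ⟨j, hj⟩ else false
  let restrict : (Fin n → Bool) → {j : Fin n // j ≤ i} → Bool := fun z j => z j
  let G : ({j : Fin n // j ≤ i} → Bool) → {j : Fin n // j ≤ i} → Bool :=
    fun q => restrict (F (extend q))
  have hG (z : Fin n → Bool) : G (restrict z) = restrict (F z) := by
    ext ⟨j, hj⟩
    refine DoesNotDependOn.eq_of_agree (h := fun w => F w j) (· ≤ i)
      (fun m hm => hT j m (hj.trans_lt (not_le.mp hm))) fun k hk => ?_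
    simp [extend, restrict, hk]
  have hsurj : Function.Surjective G := by
    intro q
    obtain ⟨z, hz⟩ := hF (extend q)
    refine ⟨restrict z, ?_⟩
    rw [hG, hz]
    ext ⟨j, hj⟩
    simp [extend, restrict, hj]
  have heq : restrict x = restrict y := by
    apply Finite.injective_iff_surjective.mpr hsurj
    rw [hG, hG]
    ext ⟨j, hj⟩
    exact hxy j hj
  exact fun j hj => congrFun heq ⟨j, hj⟩

theorem tfunction_invertibility_criterion
    (n : ℕ) (hn : 1 ≤ n)
    (F : (Fin n → Bool) → (Fin n → Bool))
    (hT : ∀ (i m : Fin n), i < m → DoesNotDependOn (fun x => F x i) m) :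
    Function.Bijective F ↔
      ∀ i : Fin n, ∃ g : (Fin n → Bool) → Bool,
        (∀ m : Fin n, i ≤ m → DoesNotDependOn g m) ∧
        ∀ x : Fin n → Bool, F x i = xor (x i) (g x) := by
  constructor
  · intro hF i
    refine ⟨fun x => F (Function.update x i false) i, fun m hm x b => ?_, fun x => ?_⟩
    · rcases hm.eq_or_lt with rfl | hlt
      · simp
      · dsimp only
        rw [Function.update_comm hlt.ne']
        exact hT i m hlt _ b
    · cases hx : x i with
      | false => simp [(Function.update_eq_self_iff (f := x) (a := i)).mpr hx.symm]
      | true =>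
        have hne : F x i ≠ F (Function.update x i false) i := by
          intro heq
          have hi := agree_of_surjective_of_agree_image hT hF.surjective i
            (x := x) (y := Function.update x i false) (fun j hj => ?_) i le_rfl
          · simp [hx] at hi
          · rcases hj.eq_or_lt with rfl | hlt
            · exact heq
            · exact hT j i hlt x false
        simpa using Bool.eq_not.mpr hne
  · intro h
    refine Finite.injective_iff_bijective.mp fun x y hxy => funext fun i => ?_
    induction i using WellFoundedLT.induction with
    | ind i ih =>
      obtain ⟨g, hg, hFg⟩ := h i
      have hgxy : g x = g y :=
        DoesNotDependOn.eq_of_agree (· < i) (fun m hm => hg m (not_lt.mp hm)) ih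
      have hi := congrFun hxy i
      rw [hFg, hFg, hgxy] at hi
      exact Bool.xor_left_inj.mp hi
end

section
/- Let n ≥ 1 and let f : (Fin n → Bool) → Bool be of the form f(x) = x_0 XOR g(x) for all x, where g does not depend on variable 0. Then the NLFSR state mapping S_f defined by S_f(x) i = x (i+1) for 0 ≤ i ≤ n-2 and S_f(x) (n-1) = f(x) is a bijection of (Fin n → Bool) onto itself. -/
/-- The NLFSR state mapping with feedback function `f`. -/
def nlfsrMap (n : ℕ) (f : (Fin n → Bool) → Bool) (x : Fin n → Bool) (i : Fin n) : Bool :=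
  if h : (i : ℕ) + 1 < n then x ⟨(i : ℕ) + 1, h⟩ else f x

theorem nlfsr_invertible_sufficient
    (n : ℕ) (hn : 0 < n)
    (f : (Fin n → Bool) → Bool)
    (g : (Fin n → Bool) → Bool)
    (hg : DoesNotDependOn g ⟨0, hn⟩)
    (hf : ∀ x : Fin n → Bool, f x = xor (x ⟨0, hn⟩) (g x)) :
    Function.Bijective (nlfsrMap n f) := by
  refine Finite.injective_iff_bijective.mp fun x y hxy => ?_
  have tail_eq : ∀ (k : ℕ) (hk : k + 1 < n), x ⟨k + 1, hk⟩ = y ⟨k + 1, hk⟩ := by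
    intro k hk
    simpa [nlfsrMap, hk] using congrFun hxy ⟨k, by omega⟩
  have feedback_eq : f x = f y := by
    have h : ¬ n - 1 + 1 < n := by omega
    simpa [nlfsrMap, h] using congrFun hxy ⟨n - 1, by omega⟩
  have update_eq : Function.update x ⟨0, hn⟩ (y ⟨0, hn⟩) = y := by
    funext ⟨i, hi⟩
    cases i with
    | zero => simp
    | succ k => simpa [Function.update_apply] using tail_eq k hi
  have g_eq : g x = g y := by rw [hg x (y ⟨0, hn⟩), update_eq]
  have head_eq : x ⟨0, hn⟩ = y ⟨0, hn⟩ := by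
    rw [hf x, hf y, g_eq] at feedback_eq
    exact Bool.xor_left_inj.mp feedback_eq
  rw [← update_eq, ← head_eq, Function.update_eq_self]
end

section
/- Let n ≥ 1 and let f : (Fin n → Bool) → Bool be a feedback function such that the NLFSR state mapping S_f (defined by S_f(x) i = x (i+1) for 0 ≤ i ≤ n-2 and S_f(x) (n-1) = f(x)) is injective. Then there exists a function g : (Fin n → Bool) → Bool that does not depend on variable 0 such that f(x) = x_0 XOR g(x) for all x; equivalently, for every x one has f(Function.update x 0 true) = ! f(Function.update x 0 false). -/
theorem feedback_update_ne_of_injective {n : ℕ} (hn : 0 < n) {f : (Fin n → Bool) → Bool}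
    (hinj : Function.Injective (nlfsrMap n f)) (x : Fin n → Bool) :
    f (Function.update x ⟨0, hn⟩ true) ≠ f (Function.update x ⟨0, hn⟩ false) := by
  intro h
  have hmap : nlfsrMap n f (Function.update x ⟨0, hn⟩ true) =
      nlfsrMap n f (Function.update x ⟨0, hn⟩ false) := by
    funext i
    unfold nlfsrMap
    split_ifs
    · simp
    · exact h
  simpa using congrFun (hinj hmap) ⟨0, hn⟩

theorem nlfsr_invertible_necessary
    (n : ℕ) (hn : 0 < n)
    (f : (Fin n → Bool) → Bool)
    (hinj : Function.Injective (nlfsrMap n f)) :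
    (∃ g : (Fin n → Bool) → Bool, DoesNotDependOn g ⟨0, hn⟩ ∧
      ∀ x : Fin n → Bool, f x = xor (x ⟨0, hn⟩) (g x)) ∧
    (∀ x : Fin n → Bool,
      f (Function.update x ⟨0, hn⟩ true) = ! f (Function.update x ⟨0, hn⟩ false)) := by
  have hcompl (x : Fin n → Bool) :
      f (Function.update x ⟨0, hn⟩ true) = ! f (Function.update x ⟨0, hn⟩ false) :=
    Bool.eq_not.mpr (feedback_update_ne_of_injective hn hinj x)
  refine ⟨⟨fun x => f (Function.update x ⟨0, hn⟩ false), fun x b => by simp, fun x => ?_⟩, hcompl⟩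
  have hx := Function.update_eq_self (⟨0, hn⟩ : Fin n) x
  cases h0 : x ⟨0, hn⟩ <;> rw [h0] at hx
  · simp [hx]
  · simpa [hx] using hcompl x
end

section
/- Under the hypotheses of the paper's sufficient condition for invertibility — F : (Fin n → Bool) → (Fin n → Bool) with coordinate functions f_i, a permutation σ of Fin n, pairwise distinct indices j_0, …, j_{n-1}, and functions g_0, …, g_{n-1} such that for every k, f_{σ(k)}(x) = x_{j_k} XOR g_k(x) with g_k not depending on variable j_k, g_0 constant, and dep(g_k) ⊆ dep(f_{σ(0)}) ∪ … ∪ dep(f_{σ(k-1)}) for k ≥ 1 — one has, for every k ∈ {0, …, n-1}, the inclusion dep(f_{σ(k)}) ⊆ {j_0, j_1, …, j_k}. -/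
/-- The parity of a single variable and a function `g` depends only on that variable and on the
variables of `g`. -/
theorem dep_xor_subset {n : ℕ} (a : Fin n) (g : (Fin n → Bool) → Bool) :
    dep (fun x => xor (x a) (g x)) ⊆ insert a (dep g) := by
  intro i hi
  by_contra hni
  rw [Set.mem_insert_iff, not_or] at hni
  obtain ⟨hia, hig⟩ := hni
  have hg : DoesNotDependOn g i := not_not.mp hig
  refine hi fun x b => ?_
  simp only [Function.update_of_ne (Ne.symm hia), ← hg x b]

theorem triangulation_dependence_inclusion
    (n : ℕ) (hn : 1 ≤ n)
    (F : (Fin n → Bool) → (Fin n → Bool))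
    (σ : Equiv.Perm (Fin n))
    (j : Fin n → Fin n) (hj : Function.Injective j)
    (g : Fin n → (Fin n → Bool) → Bool)
    (hform : ∀ (k : Fin n) (x : Fin n → Bool), F x (σ k) = xor (x (j k)) (g k x))
    (hfree : ∀ k : Fin n, DoesNotDependOn (g k) (j k))
    (htri : ∀ k : Fin n,
      dep (g k) ⊆ ⋃ (m : Fin n) (_ : m < k), dep (fun x => F x (σ m))) :
    ∀ k : Fin n, dep (fun x => F x (σ k)) ⊆ {i : Fin n | ∃ m : Fin n, m ≤ k ∧ j m = i} := by
  intro k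
  induction k using WellFoundedLT.induction with
  | ind k ih =>
    intro i hi
    simp only [hform] at hi
    rcases dep_xor_subset (j k) (g k) hi with rfl | hig
    · exact ⟨k, le_rfl, rfl⟩
    · obtain ⟨m, hmk, him⟩ := Set.mem_iUnion₂.mp (htri k hig)
      obtain ⟨l, hlm, hl⟩ := ih m hmk him
      exact ⟨l, hlm.trans hmk.le, hl⟩
end
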